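/- arXiv:2506.09721 — 4 statements merged into one kernel-verified Lean document; each statement's English description precedes it below -/
import Mathlib

section
/- Let P2 and P3 be probability measures on ℝⁿ × ℝᵏ that are absolutely continuous with respect to Lebesgue measure, with densities p2 and p3, and let P1 be a probability measure on ℝⁿ absolutely continuous with respect to Lebesgue measure with density p1. Denote by p2m(a) = ∫_{ℝᵏ} p2(a,s) ds the density of the first marginal of P2, and by q(s|a) = p3(a,s) / ∫_{ℝᵏ} p3(a,s') ds' the conditional density of P3 given a. Define ELBO(a) = ∫_{ℝᵏ} log( p2(a,s) / q(s|a) ) q(s|a) ds and MELBO = ∫_{ℝⁿ} ( −log p1(a) + ELBO(a) ) p1(a) da. Then, assuming all the above integrals exist and are finite, −D_KL(P1 ‖ P2(da)) ≥ MELBO, where P2(da) is the first marginal of P2. -/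
open MeasureTheory

/-- **Jensen's inequality for the logarithm**, in density form: if `g` is a positive probability
density, then `∫ log (f / g) g` is at most the logarithm of `∫ f`. -/
theorem integral_log_div_mul_le_log_integral {α : Type*} [MeasurableSpace α] {μ : Measure α}
    {f g : α → ℝ} (hf : Integrable f μ) (hf_pos : ∀ x, 0 < f x)
    (hg_pos : ∀ x, 0 < g x) (hg : ∫ x, g x ∂μ = 1)
    (hfg : Integrable (fun x => Real.log (f x / g x) * g x) μ) :
    ∫ x, Real.log (f x / g x) * g x ∂μ ≤ Real.log (∫ x, f x ∂μ) := by
  have hg_int : Integrable g μ := .of_integral_ne_zero (by simp [hg])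
  have hμ : μ Set.univ ≠ 0 := by
    intro h
    simp [Measure.measure_univ_eq_zero.mp h] at hg
  have hm : 0 < ∫ x, f x ∂μ := by
    rw [integral_pos_iff_support_of_nonneg (fun x => (hf_pos x).le) hf,
      Function.support_eq_univ (fun x => (hf_pos x).ne')]
    exact pos_iff_ne_zero.mpr hμ
  set m := ∫ x, f x ∂μ with hm_def
  have hle (x : α) : Real.log (f x / g x) * g x ≤ (Real.log m - 1) * g x + f x / m := by
    have hr : 0 < f x / g x := div_pos (hf_pos x) (hg_pos x)
    have hlog := Real.log_le_sub_one_of_pos (div_pos hr hm)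
    rw [Real.log_div hr.ne' hm.ne'] at hlog
    calc Real.log (f x / g x) * g x
        ≤ (Real.log m - 1 + f x / g x / m) * g x :=
          mul_le_mul_of_nonneg_right (by linarith) (hg_pos x).le
      _ = (Real.log m - 1) * g x + f x / m := by
          have := (hg_pos x).ne'
          field_simp
  calc ∫ x, Real.log (f x / g x) * g x ∂μ
      ≤ ∫ x, ((Real.log m - 1) * g x + f x / m) ∂μ :=
        integral_mono hfg ((hg_int.const_mul _).add (hf.div_const _)) hle
    _ = Real.log m := by
        rw [integral_add (hg_int.const_mul _) (hf.div_const _), integral_const_mul,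
          integral_div, hg, ← hm_def, div_self hm.ne']
        ring

/-- **Evidence Lower Bound (ELBO) inequality.**
Let `P2, P3` be probability measures on `ℝⁿ × ℝᵏ`, absolutely continuous with respect to
Lebesgue measure with densities `p2, p3`, and let `P1` be a probability measure on `ℝⁿ`
with Lebesgue density `p1`.  Let `p2marg a = ∫ p2 (a, s) ds` be the density of the first
marginal of `P2`, and `q s a = p3 (a, s) / ∫ p3 (a, s') ds'` the conditional density of `P3`
given `a`.  With `ELBO a = ∫ log (p2 (a, s) / q s a) * q s a ds` and
`MELBO = ∫ (-log (p1 a) + ELBO a) * p1 a da`, assuming all the integrals involved exist and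
are finite, one has `-D_KL(P1 ‖ P2(da)) ≥ MELBO`, where the Kullback–Leibler divergence of
`P1` from the first marginal of `P2` is expressed through the densities as
`∫ log (p1 a / p2marg a) * p1 a da`. -/
theorem elbo_inequality (n k : ℕ)
    (P1 : Measure (Fin n → ℝ)) (P2 P3 : Measure ((Fin n → ℝ) × (Fin k → ℝ)))
    [IsProbabilityMeasure P1] [IsProbabilityMeasure P2] [IsProbabilityMeasure P3]
    (p1 : (Fin n → ℝ) → ℝ) (p2 p3 : (Fin n → ℝ) × (Fin k → ℝ) → ℝ)
    (hp1meas : Measurable p1) (hp2meas : Measurable p2) (hp3meas : Measurable p3)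
    -- the densities are (strictly) positive, so that all the logarithms are well defined
    (hp1pos : ∀ a, 0 < p1 a) (hp2pos : ∀ x, 0 < p2 x) (hp3pos : ∀ x, 0 < p3 x)
    -- `P1`, `P2`, `P3` are absolutely continuous with densities `p1`, `p2`, `p3`
    (hP1 : P1 = volume.withDensity (fun a => ENNReal.ofReal (p1 a)))
    (hP2 : P2 = volume.withDensity (fun x => ENNReal.ofReal (p2 x)))
    (hP3 : P3 = volume.withDensity (fun x => ENNReal.ofReal (p3 x)))
    -- `p2marg` is the density of the first marginal `P2(da)` of `P2`
    (p2marg : (Fin n → ℝ) → ℝ)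
    (hp2marg : ∀ a, p2marg a = ∫ s, p2 (a, s))
    -- `q s a` is the conditional density of `P3` given `a`
    (q : (Fin k → ℝ) → (Fin n → ℝ) → ℝ)
    (hq : ∀ s a, q s a = p3 (a, s) / ∫ s', p3 (a, s'))
    -- the conditional density is well defined: the normalizing constants are
    -- finite and positive
    (hp3int : ∀ a, Integrable (fun s => p3 (a, s)))
    (hp3norm : ∀ a, 0 < ∫ s, p3 (a, s))
    (hp2int : ∀ a, Integrable (fun s => p2 (a, s)))
    -- the Evidence Lower Bound
    (ELBO : (Fin n → ℝ) → ℝ)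
    (hELBO : ∀ a, ELBO a = ∫ s, Real.log (p2 (a, s) / q s a) * q s a)
    -- the Mean Evidence Lower Bound
    (MELBO : ℝ)
    (hMELBO : MELBO = ∫ a, (-Real.log (p1 a) + ELBO a) * p1 a)
    -- all the integrals above exist and are finite
    (hELBOint : ∀ a, Integrable (fun s => Real.log (p2 (a, s) / q s a) * q s a))
    (hMELBOint : Integrable (fun a => (-Real.log (p1 a) + ELBO a) * p1 a))
    (hKLint : Integrable (fun a => Real.log (p1 a / p2marg a) * p1 a))
    -- `P1` is absolutely continuous with respect to the first marginal of `P2`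
    (hac : P1 ≪ P2.map Prod.fst) :
    -(∫ a, Real.log (p1 a / p2marg a) * p1 a) ≥ MELBO := by
  have hp2norm (a : Fin n → ℝ) : 0 < p2marg a := by
    rw [hp2marg, integral_pos_iff_support_of_nonneg (fun s => (hp2pos (a, s)).le) (hp2int a),
      Function.support_eq_univ (fun s => (hp2pos (a, s)).ne')]
    exact Measure.measure_univ_pos.mpr (NeZero.ne _)
  have hELBO_le (a : Fin n → ℝ) : ELBO a ≤ Real.log (p2marg a) := by
    rw [hELBO, hp2marg]
    refine integral_log_div_mul_le_log_integral (hp2int a) (fun s => hp2pos (a, s))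
      (fun s => ?_) ?_ (hELBOint a)
    · rw [hq]
      exact div_pos (hp3pos _) (hp3norm a)
    · simp only [hq]
      rw [integral_div, div_self (hp3norm a).ne']
  rw [ge_iff_le, hMELBO, ← integral_neg]
  refine integral_mono hMELBOint hKLint.neg fun a => ?_
  change _ ≤ -(Real.log (p1 a / p2marg a) * p1 a)
  rw [Real.log_div (hp1pos a).ne' (hp2norm a).ne', ← neg_mul]
  exact mul_le_mul_of_nonneg_right (by linarith [hELBO_le a]) (hp1pos a).le
end

section
/- Let P1 and P2 be probability measures on ℝⁿ and let g : ℝⁿ → ℝ be a continuous function with 0 < g(a) < 1 for all a, such that log(g) is P1-integrable and log(1−g) is P2-integrable. Then 2·D_JS(P1‖P2) ≥ 2·log 2 + ∫_{ℝⁿ} log(g(a)) dP1(a) + ∫_{ℝⁿ} log(1−g(a)) dP2(a). -/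
open MeasureTheory ENNReal

/-- The Kullback–Leibler divergence `D_KL(P ‖ Q)`, equal to `∫ log (dP/dQ) dP` when `P ≪ Q`
(and this integral exists), and `+∞` otherwise. -/
noncomputable def klDiv {α : Type*} [MeasurableSpace α] (P Q : Measure α) : ℝ≥0∞ :=
  open scoped Classical in
  if P ≪ Q ∧ Integrable (llr P Q) P then ENNReal.ofReal (∫ a, llr P Q a ∂P) else ⊤

/-- The Jensen–Shannon divergence
`D_JS(P1 ‖ P2) = D_KL(P1 ‖ ½P1 + ½P2) + D_KL(P2 ‖ ½P1 + ½P2)`. -/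
noncomputable def jsDiv {α : Type*} [MeasurableSpace α] (P1 P2 : Measure α) : ℝ≥0∞ :=
  klDiv P1 ((2 : ℝ≥0∞)⁻¹ • P1 + (2 : ℝ≥0∞)⁻¹ • P2) +
    klDiv P2 ((2 : ℝ≥0∞)⁻¹ • P1 + (2 : ℝ≥0∞)⁻¹ • P2)

open Measure in
theorem rnDeriv_le_of_le_smul {α : Type*} [MeasurableSpace α] {P M : Measure α} [SigmaFinite M]
    {c : ℝ≥0∞} (h : P ≤ c • M) : ∀ᵐ x ∂M, P.rnDeriv M x ≤ c := by
  refine ae_le_of_forall_setLIntegral_le_of_sigmaFinite (measurable_rnDeriv P M) fun s _ _ => ?_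
  rw [setLIntegral_const]
  exact (setLIntegral_rnDeriv_le s).trans (h s)

theorem abs_mul_log_le_two {r : ℝ} (h0 : 0 ≤ r) (h2 : r ≤ 2) : |r * Real.log r| ≤ 2 := by
  rcases h0.eq_or_lt with rfl | hr
  · simp
  · have hlow := mul_le_mul_of_nonneg_left (Real.one_sub_inv_le_log_of_pos hr) h0
    rw [mul_sub, mul_inv_cancel₀ hr.ne'] at hlow
    have hup := mul_le_mul_of_nonneg_left (Real.log_le_sub_one_of_pos hr) h0
    rw [abs_le]
    constructor <;> nlinarith

theorem integrable_llr_of_le_two_smul {α : Type*} [MeasurableSpace α] {P M : Measure α}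
    [IsFiniteMeasure P] [IsFiniteMeasure M] (h : P ≤ (2 : ℝ≥0∞) • M) :
    Integrable (llr P M) P := by
  rw [← integrable_rnDeriv_mul_log_iff (Measure.absolutelyContinuous_of_le_smul h)]
  have hr : Measurable fun x => (P.rnDeriv M x).toReal :=
    (Measure.measurable_rnDeriv P M).ennreal_toReal
  refine Integrable.of_bound (hr.mul hr.log).aestronglyMeasurable 2 ?_
  filter_upwards [rnDeriv_le_of_le_smul h] with x hx
  exact abs_mul_log_le_two ENNReal.toReal_nonneg (ENNReal.toReal_mono (by simp) hx)

theorem mul_log_sub_mul_log_le {r h : ℝ} (hr : 0 ≤ r) (hh : 0 < h) :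
    r * Real.log h - r * Real.log r ≤ h - r := by
  rcases hr.eq_or_lt with rfl | hr
  · simpa using hh.le
  · have key := mul_le_mul_of_nonneg_left (Real.log_le_sub_one_of_pos (div_pos hh hr)) hr.le
    rw [Real.log_div hh.ne' hr.ne', mul_sub, mul_sub, mul_div_cancel₀ _ hr.ne'] at key
    linarith

/-- The variational lower bound for the Kullback–Leibler divergence. -/
theorem integral_log_le_integral_llr {α : Type*} [MeasurableSpace α] {P M : Measure α}
    [IsProbabilityMeasure P] [IsFiniteMeasure M] (hPM : P ≪ M) (hllr : Integrable (llr P M) P)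
    {h : α → ℝ} (hpos : ∀ x, 0 < h x) (hM : Integrable h M)
    (hP : Integrable (fun x => Real.log (h x)) P) :
    ∫ x, Real.log (h x) ∂P ≤ ∫ x, llr P M x ∂P + (∫ x, h x ∂M - 1) := by
  have hint₁ : Integrable (fun x => (P.rnDeriv M x).toReal * Real.log (h x)) M :=
    (integrable_rnDeriv_smul_iff hPM).2 hP
  have hint₂ := (integrable_rnDeriv_mul_log_iff hPM).2 hllr
  have hint₃ : Integrable (fun x => (P.rnDeriv M x).toReal) M := Measure.integrable_toReal_rnDeriv
  have hmono := integral_mono (hint₁.sub hint₂) (hM.sub hint₃)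
    fun x => mul_log_sub_mul_log_le ENNReal.toReal_nonneg (hpos x)
  simp only [Pi.sub_apply] at hmono
  rw [integral_sub hint₁ hint₂, integral_sub hM hint₃, integral_rnDeriv_mul_log hPM,
    Measure.integral_toReal_rnDeriv hPM, probReal_univ] at hmono
  have heq : ∫ x, (P.rnDeriv M x).toReal * Real.log (h x) ∂M = ∫ x, Real.log (h x) ∂P :=
    integral_rnDeriv_smul hPM
  linarith

theorem klDiv_ne_top_of_le_two_smul {α : Type*} [MeasurableSpace α] {P M : Measure α}
    [IsFiniteMeasure P] [IsFiniteMeasure M] (h : P ≤ (2 : ℝ≥0∞) • M) : klDiv P M ≠ ⊤ := by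
  rw [klDiv, if_pos ⟨Measure.absolutelyContinuous_of_le_smul h, integrable_llr_of_le_two_smul h⟩]
  exact ENNReal.ofReal_ne_top

theorem log_two_add_integral_log_le_klDiv {α : Type*} [MeasurableSpace α] {P M : Measure α}
    [IsProbabilityMeasure P] [IsFiniteMeasure M] (hPM : P ≤ (2 : ℝ≥0∞) • M)
    {h : α → ℝ} (hpos : ∀ x, 0 < h x) (hM : Integrable h M)
    (hP : Integrable (fun x => Real.log (h x)) P) :
    Real.log 2 + ∫ x, Real.log (h x) ∂P ≤ (klDiv P M).toReal + (2 * ∫ x, h x ∂M - 1) := by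
  have hac := Measure.absolutelyContinuous_of_le_smul hPM
  have hllr := integrable_llr_of_le_two_smul hPM
  have hlog : (fun x => Real.log (2 * h x)) = fun x => Real.log 2 + Real.log (h x) :=
    funext fun x => Real.log_mul two_ne_zero (hpos x).ne'
  have key := integral_log_le_integral_llr hac hllr (fun x => mul_pos two_pos (hpos x))
    (hM.const_mul 2) (by rw [hlog]; exact (integrable_const _).add hP)
  rw [hlog, integral_add (integrable_const _) hP, integral_const, probReal_univ, one_smul,
    integral_const_mul] at key
  have hkl : ∫ x, llr P M x ∂P ≤ (klDiv P M).toReal := by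
    rw [klDiv, if_pos ⟨hac, hllr⟩, ENNReal.toReal_ofReal']
    exact le_max_left _ _
  linarith

theorem two_smul_mixture {α : Type*} [MeasurableSpace α] (P Q : Measure α) :
    (2 : ℝ≥0∞) • ((2 : ℝ≥0∞)⁻¹ • P + (2 : ℝ≥0∞)⁻¹ • Q) = P + Q := by
  rw [smul_add, smul_smul, smul_smul, ENNReal.mul_inv_cancel two_ne_zero ENNReal.ofNat_ne_top,
    one_smul, one_smul]

/-- **Discriminator lower bound for the Jensen–Shannon divergence.**
Let `P1`, `P2` be probability measures on `ℝⁿ` and `g : ℝⁿ → ℝ` a continuous function with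
`0 < g a < 1` for all `a`, such that `log g` is `P1`-integrable and `log (1 - g)` is
`P2`-integrable.  Then
`2 D_JS(P1 ‖ P2) ≥ 2 log 2 + ∫ log (g a) dP1 + ∫ log (1 - g a) dP2`.
(Both Kullback–Leibler terms in `D_JS` are finite, so the divergence is stated via its real
value `(jsDiv P1 P2).toReal`.) -/
theorem jsDiv_discriminator_lower_bound (n : ℕ)
    (P1 P2 : Measure (Fin n → ℝ)) [IsProbabilityMeasure P1] [IsProbabilityMeasure P2]
    (g : (Fin n → ℝ) → ℝ) (hg : Continuous g)
    (hg0 : ∀ a, 0 < g a) (hg1 : ∀ a, g a < 1)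
    (hint1 : Integrable (fun a => Real.log (g a)) P1)
    (hint2 : Integrable (fun a => Real.log (1 - g a)) P2) :
    2 * (jsDiv P1 P2).toReal ≥
      2 * Real.log 2 + (∫ a, Real.log (g a) ∂P1) + ∫ a, Real.log (1 - g a) ∂P2 := by
  set M := (2 : ℝ≥0∞)⁻¹ • P1 + (2 : ℝ≥0∞)⁻¹ • P2 with hM
  have : IsProbabilityMeasure M := ⟨by simp [hM, ENNReal.inv_two_add_inv_two]⟩
  have hM2 : (2 : ℝ≥0∞) • M = P1 + P2 := two_smul_mixture P1 P2
  have hle1 : P1 ≤ (2 : ℝ≥0∞) • M := hM2 ▸ Measure.le_add_right le_rfl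
  have hle2 : P2 ≤ (2 : ℝ≥0∞) • M := hM2 ▸ Measure.le_add_left le_rfl
  have hgM : Integrable g M := Integrable.of_bound hg.aestronglyMeasurable 1
    (ae_of_all _ fun a => by rw [Real.norm_eq_abs, abs_of_pos (hg0 a)]; exact (hg1 a).le)
  have key1 := log_two_add_integral_log_le_klDiv hle1 hg0 hgM hint1
  have key2 := log_two_add_integral_log_le_klDiv hle2 (fun a => sub_pos.2 (hg1 a))
    ((integrable_const 1).sub hgM) hint2
  rw [integral_sub (integrable_const 1) hgM, integral_const, probReal_univ, one_smul] at key2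
  have hjs : (jsDiv P1 P2).toReal = (klDiv P1 M).toReal + (klDiv P2 M).toReal :=
    ENNReal.toReal_add (klDiv_ne_top_of_le_two_smul hle1) (klDiv_ne_top_of_le_two_smul hle2)
  have hnonneg : 0 ≤ (jsDiv P1 P2).toReal := ENNReal.toReal_nonneg
  linarith
end

section
/- Let P and P_m (m ∈ ℕ) be probability measures on ℝⁿ with finite first absolute moments. If for every Lipschitz function f : ℝⁿ → ℝ one has ∫ f dP_m → ∫ f dP as m → ∞ (all these integrals being finite), then W1(P_m, P) → 0 as m → ∞. -/
open MeasureTheory ENNReal NNReal Filter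

/-- `γ` is a coupling of `P1` and `P2`: a probability measure on the product whose first
marginal is `P1` and whose second marginal is `P2`. -/
def IsCoupling {α : Type*} [MeasurableSpace α] (γ : Measure (α × α)) (P1 P2 : Measure α) :
    Prop :=
  IsProbabilityMeasure γ ∧ γ.map Prod.fst = P1 ∧ γ.map Prod.snd = P2

/-- The 1-Wasserstein distance: the infimum over all couplings `γ` of `P1` and `P2` of
`∫ ‖a - b‖ dγ(a, b)`. -/
noncomputable def W1 {α : Type*} [MeasurableSpace α] [NormedAddCommGroup α]
    (P1 P2 : Measure α) : ℝ≥0∞ :=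
  ⨅ (γ : Measure (α × α)) (_ : IsCoupling γ P1 P2),
    ∫⁻ x, ENNReal.ofReal ‖x.1 - x.2‖ ∂γ

open scoped Topology

section

variable {E : Type*} [NormedAddCommGroup E] [MeasurableSpace E]

/-- A finite partial coupling `γ` can be completed by an independent coupling of the remaining
masses. -/
theorem W1_le_of_partial_coupling [BorelSpace E] [SecondCountableTopology E]
    {P Q : Measure E} [IsProbabilityMeasure P] [IsProbabilityMeasure Q]
    {γ : Measure (E × E)} {μ ν : Measure E}
    (hfst : γ.map Prod.fst + μ = P) (hsnd : γ.map Prod.snd + ν = Q) :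
    W1 P Q ≤ ∫⁻ x, ENNReal.ofReal ‖x.1 - x.2‖ ∂γ + ∫⁻ a, ENNReal.ofReal ‖a‖ ∂μ
      + ∫⁻ b, ENNReal.ofReal ‖b‖ ∂ν := by
  have hP : γ Set.univ + μ Set.univ = 1 := by
    rw [← measure_univ (μ := P), ← hfst, Measure.add_apply,
      Measure.map_apply measurable_fst .univ, Set.preimage_univ]
  have hQ : γ Set.univ + ν Set.univ = 1 := by
    rw [← measure_univ (μ := Q), ← hsnd, Measure.add_apply,
      Measure.map_apply measurable_snd .univ, Set.preimage_univ]
  have hγ : γ Set.univ ≠ ∞ := fun h => by simp [h] at hP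
  have hμ : μ Set.univ ≠ ∞ := fun h => by simp [h] at hP
  have hmass : μ Set.univ = ν Set.univ := (ENNReal.add_right_inj hγ).1 (hP.trans hQ.symm)
  have : IsFiniteMeasure μ := ⟨hμ.lt_top⟩
  have : IsFiniteMeasure ν := ⟨by rw [← hmass]; exact hμ.lt_top⟩
  have hcancel (ρ : Measure E) (hρ : ρ Set.univ = μ Set.univ) :
      (μ Set.univ)⁻¹ • μ Set.univ • ρ = ρ := by
    by_cases h : μ Set.univ = 0
    · rw [Measure.measure_univ_eq_zero.1 (hρ.trans h)]
      simp
    · rw [smul_smul, ENNReal.inv_mul_cancel h hμ, one_smul]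
  set η : Measure (E × E) := (μ Set.univ)⁻¹ • μ.prod ν with hη
  have hη1 : η.map Prod.fst = μ := by
    rw [hη, Measure.map_smul, Measure.map_fst_prod, ← hmass, hcancel μ rfl]
  have hη2 : η.map Prod.snd = ν := by
    rw [hη, Measure.map_smul, Measure.map_snd_prod, hcancel ν hmass.symm]
  have hcost : ∫⁻ x, ENNReal.ofReal ‖x.1 - x.2‖ ∂η
      ≤ ∫⁻ a, ENNReal.ofReal ‖a‖ ∂μ + ∫⁻ b, ENNReal.ofReal ‖b‖ ∂ν := by
    have h1 : ∫⁻ a, ENNReal.ofReal ‖a‖ ∂μ = ∫⁻ x, ENNReal.ofReal ‖x.1‖ ∂η := by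
      conv_lhs => rw [← hη1]
      exact lintegral_map (by fun_prop) measurable_fst
    have h2 : ∫⁻ b, ENNReal.ofReal ‖b‖ ∂ν = ∫⁻ x, ENNReal.ofReal ‖x.2‖ ∂η := by
      conv_lhs => rw [← hη2]
      exact lintegral_map (by fun_prop) measurable_snd
    rw [h1, h2, ← lintegral_add_left (by fun_prop)]
    refine lintegral_mono fun x => ?_
    rw [← ENNReal.ofReal_add (norm_nonneg _) (norm_nonneg _)]
    exact ENNReal.ofReal_le_ofReal (norm_sub_le _ _)
  have hcoupling : IsCoupling (γ + η) P Q := by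
    have hmap1 : (γ + η).map Prod.fst = P := by
      rw [Measure.map_add _ _ measurable_fst, hη1, hfst]
    refine ⟨⟨?_⟩, hmap1, by rw [Measure.map_add _ _ measurable_snd, hη2, hsnd]⟩
    rw [← measure_univ (μ := P), ← hmap1, Measure.map_apply measurable_fst .univ,
      Set.preimage_univ]
  refine (iInf₂_le (γ + η) hcoupling).trans ?_
  rw [lintegral_add_measure, add_assoc]
  gcongr

/-- Coupling the pieces of two measures cut out by a finite family of bump functions of small
support. -/
theorem exists_partial_coupling_of_bumps {ι : Type*} (s : Finset ι) (φ : ι → E → ℝ≥0∞)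
    (hφ : ∀ i, Measurable (φ i)) (hsum : ∀ x, ∑ i ∈ s, φ i x ≤ 1) {d : ℝ}
    (hdiam : ∀ i x y, φ i x ≠ 0 → φ i y ≠ 0 → ‖x - y‖ ≤ d)
    (P Q : Measure E) [IsProbabilityMeasure P] [IsProbabilityMeasure Q] :
    ∃ γ : Measure (E × E), γ.map Prod.fst ≤ P ∧ γ.map Prod.snd ≤ Q ∧
      γ Set.univ = ∑ i ∈ s, min (∫⁻ x, φ i x ∂P) (∫⁻ x, φ i x ∂Q) ∧
      ∫⁻ x, ENNReal.ofReal ‖x.1 - x.2‖ ∂γ ≤ ENNReal.ofReal d := by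
  have hfin (ρ : Measure E) [IsProbabilityMeasure ρ] (i : ι) (hi : i ∈ s) :
      ∫⁻ x, φ i x ∂ρ ≠ ∞ := by
    have : ∫⁻ x, φ i x ∂ρ ≤ ∫⁻ _, 1 ∂ρ := lintegral_mono fun x =>
      (Finset.single_le_sum (f := fun j => φ j x) (fun _ _ => zero_le) hi).trans (hsum x)
    exact ne_top_of_le_ne_top (by simp) this
  have hsub (ρ : Measure E) : ∑ i ∈ s, ρ.withDensity (φ i) ≤ ρ := by
    refine Measure.le_iff.2 fun t ht => ?_
    rw [Measure.finsetSum_apply]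
    simp_rw [withDensity_apply _ ht]
    rw [← lintegral_finsetSum _ fun i _ => hφ i]
    calc ∫⁻ x in t, ∑ i ∈ s, φ i x ∂ρ ≤ ∫⁻ _ in t, 1 ∂ρ := lintegral_mono fun x => hsum x
      _ = ρ t := by simp
  set p : ι → ℝ≥0∞ := fun i => ∫⁻ x, φ i x ∂P with hp
  set q : ι → ℝ≥0∞ := fun i => ∫⁻ x, φ i x ∂Q with hq
  have hPu (i : ι) : P.withDensity (φ i) Set.univ = p i := by simp [hp]
  have hQu (i : ι) : Q.withDensity (φ i) Set.univ = q i := by simp [hq]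
  set γ : Measure (E × E) := ∑ i ∈ s,
    (max (p i) (q i))⁻¹ • (P.withDensity (φ i)).prod (Q.withDensity (φ i)) with hγ
  have hone (a b : ℝ≥0∞) (hab : a ≤ b) : b⁻¹ * a ≤ 1 :=
    (mul_le_mul_right hab _).trans (ENNReal.inv_mul_le_one _)
  have hsf (i : ι) (hi : i ∈ s) : IsFiniteMeasure (P.withDensity (φ i)) :=
    isFiniteMeasure_withDensity (hfin P i hi)
  have hsf' (i : ι) (hi : i ∈ s) : IsFiniteMeasure (Q.withDensity (φ i)) :=
    isFiniteMeasure_withDensity (hfin Q i hi)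
  have hmap1 : γ.map Prod.fst ≤ P := by
    refine le_trans ?_ (hsub P)
    rw [hγ, Measure.map_finset_sum measurable_fst.aemeasurable]
    refine Finset.sum_le_sum fun i hi => ?_
    have := hsf i hi
    have := hsf' i hi
    rw [Measure.map_smul, Measure.map_fst_prod, hQu, smul_smul]
    refine Measure.le_iff.2 fun t _ => ?_
    rw [Measure.smul_apply, smul_eq_mul]
    exact mul_le_of_le_one_left zero_le (hone _ _ (le_max_right _ _))
  have hmap2 : γ.map Prod.snd ≤ Q := by
    refine le_trans ?_ (hsub Q)
    rw [hγ, Measure.map_finset_sum measurable_snd.aemeasurable]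
    refine Finset.sum_le_sum fun i hi => ?_
    have := hsf i hi
    have := hsf' i hi
    rw [Measure.map_smul, Measure.map_snd_prod, hPu, smul_smul]
    refine Measure.le_iff.2 fun t _ => ?_
    rw [Measure.smul_apply, smul_eq_mul]
    exact mul_le_of_le_one_left zero_le (hone _ _ (le_max_left _ _))
  refine ⟨γ, hmap1, hmap2, ?_, ?_⟩
  · rw [hγ, Measure.finsetSum_apply]
    refine Finset.sum_congr rfl fun i hi => ?_
    have := hsf i hi
    have := hsf' i hi
    rw [Measure.smul_apply, smul_eq_mul, ← Set.univ_prod_univ, Measure.prod_prod, hPu, hQu,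
      ← max_mul_min (p i) (q i), ← mul_assoc]
    by_cases h : max (p i) (q i) = 0
    · have hmin : min (p i) (q i) = 0 := le_antisymm (min_le_max.trans h.le) zero_le
      rw [hmin, mul_zero]
    · rw [ENNReal.inv_mul_cancel h (max_ne_top (hfin P i hi) (hfin Q i hi)), one_mul]
  · have hae : ∀ᵐ x ∂γ, ENNReal.ofReal ‖x.1 - x.2‖ ≤ ENNReal.ofReal d := by
      rw [hγ]
      refine ae_finsetSum_measure_iff.2 fun i hi => ?_
      have := hsf i hi
      have := hsf' i hi
      refine Measure.ae_smul_measure ?_ _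
      have h1 : ∀ᵐ x ∂P.withDensity (φ i), φ i x ≠ 0 :=
        (ae_withDensity_iff (hφ i)).2 (ae_of_all _ fun _ h => h)
      have h2 : ∀ᵐ x ∂Q.withDensity (φ i), φ i x ≠ 0 :=
        (ae_withDensity_iff (hφ i)).2 (ae_of_all _ fun _ h => h)
      filter_upwards [Measure.quasiMeasurePreserving_fst.ae h1,
        Measure.quasiMeasurePreserving_snd.ae h2] with x hx1 hx2
      exact ENNReal.ofReal_le_ofReal (hdiam i _ _ hx1 hx2)
    have hγ1 : γ Set.univ ≤ 1 := by
      rw [← Set.preimage_univ (f := Prod.fst), ← Measure.map_apply measurable_fst .univ,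
        ← measure_univ (μ := P)]
      exact hmap1 _
    calc ∫⁻ x, ENNReal.ofReal ‖x.1 - x.2‖ ∂γ ≤ ∫⁻ _, ENNReal.ofReal d ∂γ := lintegral_mono_ae hae
      _ = ENNReal.ofReal d * γ Set.univ := lintegral_const _
      _ ≤ ENNReal.ofReal d := mul_le_of_le_one_right zero_le hγ1

/-- Bound on the Wasserstein distance by the diameter of bump functions, the tails of the first
moments beyond radius `R`, and the mass that the bump functions fail to match. -/
theorem W1_le_of_bumps [BorelSpace E] [SecondCountableTopology E]
    {ι : Type*} (s : Finset ι) (φ : ι → E → ℝ≥0∞)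
    (hφ : ∀ i, Measurable (φ i)) (hsum : ∀ x, ∑ i ∈ s, φ i x ≤ 1) {d : ℝ}
    (hdiam : ∀ i x y, φ i x ≠ 0 → φ i y ≠ 0 → ‖x - y‖ ≤ d) (R : ℝ)
    (P Q : Measure E) [IsProbabilityMeasure P] [IsProbabilityMeasure Q] :
    W1 P Q ≤ ENNReal.ofReal d
      + (∫⁻ a, ENNReal.ofReal (‖a‖ - R) ∂P + ENNReal.ofReal R *
          (1 - ∑ i ∈ s, min (∫⁻ x, φ i x ∂P) (∫⁻ x, φ i x ∂Q)))
      + (∫⁻ a, ENNReal.ofReal (‖a‖ - R) ∂Q + ENNReal.ofReal R *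
          (1 - ∑ i ∈ s, min (∫⁻ x, φ i x ∂P) (∫⁻ x, φ i x ∂Q))) := by
  obtain ⟨γ, h1, h2, hmass, hcost⟩ := exists_partial_coupling_of_bumps s φ hφ hsum hdiam P Q
  have hrest (ρ ρ' : Measure E) [IsProbabilityMeasure ρ] (hle : ρ' ≤ ρ)
      (hρ' : ρ' Set.univ = γ Set.univ) :
      ∫⁻ a, ENNReal.ofReal ‖a‖ ∂(ρ - ρ') ≤ ∫⁻ a, ENNReal.ofReal (‖a‖ - R) ∂ρ
        + ENNReal.ofReal R * (1 - γ Set.univ) := by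
    have : IsFiniteMeasure ρ' := isFiniteMeasure_of_le ρ hle
    calc ∫⁻ a, ENNReal.ofReal ‖a‖ ∂(ρ - ρ')
        ≤ ∫⁻ a, (ENNReal.ofReal (‖a‖ - R) + ENNReal.ofReal R) ∂(ρ - ρ') := by
          refine lintegral_mono fun a => ?_
          simpa using ENNReal.ofReal_add_le (p := ‖a‖ - R) (q := R)
      _ = ∫⁻ a, ENNReal.ofReal (‖a‖ - R) ∂(ρ - ρ') + ENNReal.ofReal R * (1 - γ Set.univ) := by
          rw [lintegral_add_right _ measurable_const, lintegral_const,
            Measure.sub_apply .univ hle, measure_univ, hρ']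
      _ ≤ _ := by
          gcongr
          exact Measure.sub_le
  have : IsFiniteMeasure (γ.map Prod.fst) := isFiniteMeasure_of_le P h1
  have : IsFiniteMeasure (γ.map Prod.snd) := isFiniteMeasure_of_le Q h2
  refine (W1_le_of_partial_coupling (γ := γ)
    (by rw [add_comm]; exact Measure.sub_add_cancel_of_le h1)
    (by rw [add_comm]; exact Measure.sub_add_cancel_of_le h2)).trans ?_
  rw [← hmass]
  gcongr
  · exact hrest P _ h1 (by rw [Measure.map_apply measurable_fst .univ, Set.preimage_univ])
  · exact hrest Q _ h2 (by rw [Measure.map_apply measurable_snd .univ, Set.preimage_univ])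

theorem LipschitzWith.integrable_of_integrable_norm [BorelSpace E] [SecondCountableTopology E]
    {f : E → ℝ} {L : ℝ≥0} (hf : LipschitzWith L f) {P : Measure E} [IsFiniteMeasure P]
    (hP : Integrable (fun a => ‖a‖) P) : Integrable f P := by
  refine ((integrable_const ‖f 0‖).add (hP.const_mul (L : ℝ))).mono'
    hf.continuous.aestronglyMeasurable (ae_of_all _ fun a => ?_)
  have h1 := hf.norm_sub_le a 0
  have h2 := norm_sub_norm_le (f a) (f 0)
  simp only [sub_zero] at h1
  simp only [Pi.add_apply]
  linarith

end

section

variable {X : Type*} [PseudoMetricSpace X]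

/-- The trapezoidal bump equal to `1` within distance `ε` of `c` and vanishing beyond `2 * ε`. -/
noncomputable def trapezoid (ε : ℝ≥0) (c x : X) : ℝ :=
  max 0 (min 1 (2 - (ε : ℝ)⁻¹ * dist x c))

/-- The running maximum of the trapezoidal bumps around the first `k` points of a sequence. -/
noncomputable def maxTrapezoid (ε : ℝ≥0) (u : ℕ → X) : ℕ → X → ℝ
  | 0 => fun _ => 0
  | k + 1 => fun x => max (maxTrapezoid ε u k x) (trapezoid ε (u k) x)

theorem lipschitzWith_trapezoid (ε : ℝ≥0) (c : X) : LipschitzWith ε⁻¹ (trapezoid ε c) := by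
  refine LipschitzWith.const_max (LipschitzWith.const_min ?_ _) _
  refine LipschitzWith.of_dist_le_mul fun x y => ?_
  rw [Real.dist_eq, NNReal.coe_inv, show 2 - (ε : ℝ)⁻¹ * dist x c - (2 - (ε : ℝ)⁻¹ * dist y c)
    = (ε : ℝ)⁻¹ * (dist y c - dist x c) by ring, abs_mul, abs_of_nonneg (by positivity),
    dist_comm x y]
  gcongr
  exact abs_dist_sub_le _ _ _

theorem trapezoid_le_one (ε : ℝ≥0) (c x : X) : trapezoid ε c x ≤ 1 := by
  simp [trapezoid]

theorem lipschitzWith_maxTrapezoid (ε : ℝ≥0) (u : ℕ → X) (k : ℕ) :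
    LipschitzWith ε⁻¹ (maxTrapezoid ε u k) := by
  induction k with
  | zero => exact (LipschitzWith.const 0).weaken zero_le
  | succ k ih => simpa [maxTrapezoid] using ih.max (lipschitzWith_trapezoid ε (u k))

theorem maxTrapezoid_le_one (ε : ℝ≥0) (u : ℕ → X) (k : ℕ) (x : X) :
    maxTrapezoid ε u k x ≤ 1 := by
  induction k with
  | zero => simp [maxTrapezoid]
  | succ k ih => exact max_le ih (trapezoid_le_one _ _ _)

theorem monotone_maxTrapezoid (ε : ℝ≥0) (u : ℕ → X) (x : X) :
    Monotone fun k => maxTrapezoid ε u k x :=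
  monotone_nat_of_le_succ fun _ => le_max_left _ _

theorem maxTrapezoid_nonneg (ε : ℝ≥0) (u : ℕ → X) (k : ℕ) (x : X) :
    0 ≤ maxTrapezoid ε u k x :=
  monotone_maxTrapezoid ε u x (Nat.zero_le k)

theorem dist_le_of_maxTrapezoid_lt {ε : ℝ≥0} (hε : 0 < ε) {u : ℕ → X} {k : ℕ} {x : X}
    (h : maxTrapezoid ε u k x < maxTrapezoid ε u (k + 1) x) : dist x (u k) ≤ 2 * ε := by
  by_contra! hd
  refine h.not_ge (max_le le_rfl ?_)
  refine le_trans (max_le le_rfl ((min_le_right _ _).trans ?_)) (maxTrapezoid_nonneg ε u k x)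
  have hε' : (0 : ℝ) < ε := hε
  rw [sub_nonpos, inv_mul_eq_div, le_div_iff₀ hε']
  exact hd.le

theorem tendsto_maxTrapezoid {ε : ℝ≥0} (hε : 0 < ε) {u : ℕ → X} (hu : DenseRange u) (x : X) :
    Tendsto (fun k => maxTrapezoid ε u k x) atTop (𝓝 1) := by
  have hε' : (0 : ℝ) < ε := hε
  obtain ⟨j, hj⟩ := hu.exists_dist_lt x hε'
  refine tendsto_const_nhds.congr' ?_
  filter_upwards [eventually_ge_atTop (j + 1)] with k hk
  refine le_antisymm ?_ (maxTrapezoid_le_one ε u k x)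
  refine le_trans ?_ (monotone_maxTrapezoid ε u x hk)
  refine le_max_of_le_right (le_max_of_le_right (le_min le_rfl ?_))
  have : (ε : ℝ)⁻¹ * dist x (u j) ≤ 1 := by
    rw [inv_mul_eq_div, div_le_one hε']
    exact hj.le
  linarith

end

/-- **Convergence of Lipschitz integrals implies Wasserstein convergence.**
Let `P` and `P_m` (`m ∈ ℕ`) be probability measures on `ℝⁿ` with finite first absolute
moments.  If for every Lipschitz function `f : ℝⁿ → ℝ` one has `∫ f dP_m → ∫ f dP`
(all these integrals being finite, as Lipschitz functions are integrable against measures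
with finite first moment), then `W1(P_m, P) → 0`. -/
theorem lipschitz_integral_tendsto_implies_wasserstein_tendsto_zero (n : ℕ)
    (P : Measure (EuclideanSpace ℝ (Fin n))) (Pm : ℕ → Measure (EuclideanSpace ℝ (Fin n)))
    [IsProbabilityMeasure P] [∀ m, IsProbabilityMeasure (Pm m)]
    (hmom : Integrable (fun a => ‖a‖) P) (hmomm : ∀ m, Integrable (fun a => ‖a‖) (Pm m))
    (hconv : ∀ (L : ℝ≥0) (f : EuclideanSpace ℝ (Fin n) → ℝ), LipschitzWith L f →
      Tendsto (fun m => ∫ a, f a ∂(Pm m)) atTop (nhds (∫ a, f a ∂P))) :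
    Tendsto (fun m => W1 (Pm m) P) atTop (nhds 0) := by
  have hlint (f : EuclideanSpace ℝ (Fin n) → ℝ) (L : ℝ≥0) (hf : LipschitzWith L f)
      (h0 : ∀ a, 0 ≤ f a) : Tendsto (fun m => ∫⁻ a, ENNReal.ofReal (f a) ∂(Pm m)) atTop
        (𝓝 (∫⁻ a, ENNReal.ofReal (f a) ∂P)) := by
    rw [← ofReal_integral_eq_lintegral_ofReal (hf.integrable_of_integrable_norm hmom)
      (ae_of_all _ h0)]
    simp_rw [fun m => (ofReal_integral_eq_lintegral_ofReal
      (hf.integrable_of_integrable_norm (hmomm m)) (ae_of_all _ h0)).symm]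
    exact ENNReal.tendsto_ofReal (hconv L f hf)
  have htail : Tendsto (fun R : ℕ => ∫⁻ a, ENNReal.ofReal (‖a‖ - R) ∂P) atTop (𝓝 0) := by
    rw [← lintegral_zero (μ := P)]
    refine tendsto_lintegral_of_dominated_convergence (fun a => ENNReal.ofReal ‖a‖)
      (fun R => by fun_prop) (fun R => ae_of_all _ fun a => ENNReal.ofReal_le_ofReal (by simp))
      ?_ (ae_of_all _ fun a => ?_)
    · rw [← ofReal_integral_eq_lintegral_ofReal hmom (ae_of_all _ fun a => norm_nonneg a)]
      exact ENNReal.ofReal_ne_top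
    · refine tendsto_const_nhds.congr' ?_
      filter_upwards [eventually_ge_atTop ⌈‖a‖⌉₊] with R hR
      have : ‖a‖ ≤ R := (Nat.le_ceil _).trans (by exact_mod_cast hR)
      exact (ENNReal.ofReal_of_nonpos (by linarith)).symm
  have htail' (R : ℝ) : Tendsto (fun m => ∫⁻ a, ENNReal.ofReal (‖a‖ - R) ∂(Pm m)) atTop
      (𝓝 (∫⁻ a, ENNReal.ofReal (‖a‖ - R) ∂P)) := by
    have hL : LipschitzWith 1 fun a : EuclideanSpace ℝ (Fin n) => max (‖a‖ - R) 0 :=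
      (LipschitzWith.of_dist_le_mul fun x y => by
        simpa [Real.dist_eq, dist_eq_norm] using abs_norm_sub_norm_le x y).max_const 0
    simpa [ENNReal.ofReal_max] using hlint _ 1 hL fun a => le_max_right _ _
  refine ENNReal.tendsto_nhds_zero.2 fun η hη => ?_
  obtain ⟨ε, hε, hεη⟩ : ∃ ε : ℝ≥0, 0 < ε ∧ ENNReal.ofReal (4 * ε) < η := by
    have h : Tendsto (fun ε : ℝ≥0 => ENNReal.ofReal (4 * ε)) (𝓝[>] 0) (𝓝 0) := by
      have : Continuous fun ε : ℝ≥0 => ENNReal.ofReal (4 * ε) :=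
        ENNReal.continuous_ofReal.comp (by fun_prop)
      simpa using (this.tendsto 0).mono_left nhdsWithin_le_nhds
    obtain ⟨ε, h1, h2⟩ := ((h.eventually_lt_const hη).and self_mem_nhdsWithin).exists
    exact ⟨ε, h2, h1⟩
  obtain ⟨R, hR⟩ : ∃ R : ℕ, ENNReal.ofReal (4 * ε)
      + (∫⁻ a, ENNReal.ofReal (‖a‖ - R) ∂P + ENNReal.ofReal R * (1 - 1))
      + (∫⁻ a, ENNReal.ofReal (‖a‖ - R) ∂P + ENNReal.ofReal R * (1 - 1)) < η := by
    have h := (tendsto_const_nhds (x := ENNReal.ofReal (4 * ε))).add htail |>.add htail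
    simp only [add_zero] at h
    simpa using (h.eventually_lt_const hεη).exists
  set u := TopologicalSpace.denseSeq (EuclideanSpace ℝ (Fin n))
  have hmeas (k : ℕ) : Measurable fun a => maxTrapezoid ε u k a :=
    (lipschitzWith_maxTrapezoid ε u k).continuous.measurable
  set φ : ℕ → EuclideanSpace ℝ (Fin n) → ℝ≥0∞ := fun i a =>
    ENNReal.ofReal (maxTrapezoid ε u (i + 1) a - maxTrapezoid ε u i a) with hφ
  have hφm (i : ℕ) : Measurable (φ i) := ((hmeas _).sub (hmeas _)).ennreal_ofReal
  have hφnonneg (i : ℕ) (a) : 0 ≤ maxTrapezoid ε u (i + 1) a - maxTrapezoid ε u i a :=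
    sub_nonneg.2 (monotone_maxTrapezoid ε u a i.le_succ)
  have hφsum (k : ℕ) (a) :
      ∑ i ∈ Finset.range k, φ i a = ENNReal.ofReal (maxTrapezoid ε u k a) := by
    rw [hφ, ← ENNReal.ofReal_sum_of_nonneg fun i _ => hφnonneg i a,
      Finset.sum_range_sub (fun i => maxTrapezoid ε u i a)]
    simp [maxTrapezoid]
  have hφle (k : ℕ) (a) : ∑ i ∈ Finset.range k, φ i a ≤ 1 := by
    rw [hφsum]
    exact ENNReal.ofReal_le_one.2 (maxTrapezoid_le_one ε u k a)
  have hφdiam (i : ℕ) (a b) (ha : φ i a ≠ 0) (hb : φ i b ≠ 0) : ‖a - b‖ ≤ 4 * ε := by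
    have key (c) (hc : φ i c ≠ 0) : dist c (u i) ≤ 2 * ε := by
      refine dist_le_of_maxTrapezoid_lt hε ?_
      by_contra! h
      exact hc (ENNReal.ofReal_of_nonpos (sub_nonpos.2 h))
    rw [← dist_eq_norm]
    linarith [dist_triangle_right a b (u i), key a ha, key b hb]
  have hmassP : Tendsto (fun k => ∑ i ∈ Finset.range k, ∫⁻ a, φ i a ∂P) atTop (𝓝 1) := by
    have h : ∫⁻ _, 1 ∂P = 1 := by simp
    simp_rw [← lintegral_finsetSum _ fun i _ => hφm i, hφsum]
    rw [← h]
    refine tendsto_lintegral_of_dominated_convergence (fun _ => 1)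
      (fun k => (hmeas k).ennreal_ofReal)
      (fun k => ae_of_all _ fun a => ENNReal.ofReal_le_one.2 (maxTrapezoid_le_one ε u k a))
      (by simp) (ae_of_all _ fun a => ?_)
    simpa using ENNReal.tendsto_ofReal
      (tendsto_maxTrapezoid hε (TopologicalSpace.denseRange_denseSeq _) a)
  obtain ⟨k, hk⟩ : ∃ k, ENNReal.ofReal (4 * ε)
      + (∫⁻ a, ENNReal.ofReal (‖a‖ - R) ∂P
        + ENNReal.ofReal R * (1 - ∑ i ∈ Finset.range k, ∫⁻ a, φ i a ∂P))
      + (∫⁻ a, ENNReal.ofReal (‖a‖ - R) ∂P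
        + ENNReal.ofReal R * (1 - ∑ i ∈ Finset.range k, ∫⁻ a, φ i a ∂P)) < η := by
    have h := tendsto_const_nhds (x := ∫⁻ a, ENNReal.ofReal (‖a‖ - R) ∂P) |>.add
      (ENNReal.Tendsto.const_mul (ENNReal.Tendsto.sub tendsto_const_nhds hmassP (.inl one_ne_top))
        (.inr (ENNReal.ofReal_ne_top (r := R))))
    exact (((tendsto_const_nhds.add h).add h).eventually_lt_const hR).exists
  have hmass : Tendsto (fun m => ∑ i ∈ Finset.range k,
      min (∫⁻ a, φ i a ∂(Pm m)) (∫⁻ a, φ i a ∂P)) atTop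
      (𝓝 (∑ i ∈ Finset.range k, ∫⁻ a, φ i a ∂P)) := by
    refine tendsto_finsetSum _ fun i _ => ?_
    have h := hlint _ _ ((lipschitzWith_maxTrapezoid ε u (i + 1)).sub
      (lipschitzWith_maxTrapezoid ε u i)) (hφnonneg i)
    have h' := Tendsto.min h (tendsto_const_nhds (x := ∫⁻ a, φ i a ∂P))
    rwa [min_eq_right le_rfl] at h'
  have h := ENNReal.Tendsto.const_mul
    (ENNReal.Tendsto.sub tendsto_const_nhds hmass (.inl one_ne_top))
    (.inr (ENNReal.ofReal_ne_top (r := R)))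
  filter_upwards [((tendsto_const_nhds.add ((htail' R).add h)).add
    ((tendsto_const_nhds (x := ∫⁻ a, ENNReal.ofReal (‖a‖ - R) ∂P)).add h)).eventually_lt_const hk]
    with m hm
  exact (W1_le_of_bumps (Finset.range k) φ hφm (hφle k) hφdiam R (Pm m) P).trans hm.le
end

section
/- Let b : ℝᵖ × ℝᵖ × ℝᵖ → ℝˡ be multilinear in the sense that for each fixed (y,z) the map x ↦ b(x,y,z) is affine with linear part A₁(y,z), for each fixed (x,z) the map y ↦ b(x,y,z) is affine with linear part A₂(x,z), and for each fixed (x,y) the map z ↦ b(x,y,z) is affine with linear part A₃(x,y). Let (x,y,z) ∈ (ℝᵖ)³, let c ∈ ℝˡ, and set δc = c − b(x,y,z). Define successively x̃ = x + A₁(y,z)ᵀ (A₁(y,z) A₁(y,z)ᵀ)⁻¹ (δc/3), ỹ = y + A₂(x̃,z)ᵀ (A₂(x̃,z) A₂(x̃,z)ᵀ)⁻¹ (δc/3), and z̃ = z + A₃(x̃,ỹ)ᵀ (A₃(x̃,ỹ) A₃(x̃,ỹ)ᵀ)⁻¹ (δc/3). If the three Gram matrices A₁(y,z)A₁(y,z)ᵀ,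 A₂(x̃,z)A₂(x̃,z)ᵀ and A₃(x̃,ỹ)A₃(x̃,ỹ)ᵀ are invertible, then b(x̃, ỹ, z̃) = c. -/
open Matrix

/-- If the Gram matrix `A Aᵀ` is invertible, then `Aᵀ (A Aᵀ)⁻¹` is a right inverse of `A`. -/
theorem Matrix.mulVec_transpose_mulVec_gram_inv_mulVec {m n R : Type*} [Fintype m] [DecidableEq m]
    [Fintype n] [CommRing R] {A : Matrix m n R} (hA : IsUnit (A * Aᵀ)) (v : m → R) :
    A *ᵥ (Aᵀ *ᵥ ((A * Aᵀ)⁻¹ *ᵥ v)) = v := by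
  rw [mulVec_mulVec, mulVec_mulVec,
    mul_nonsing_inv _ ((isUnit_iff_isUnit_det _).mp hA), one_mulVec]

/-- **Correctness of Algorithm 2.1 for enforcing multilinear constraints.**
Let `b : ℝᵖ × ℝᵖ × ℝᵖ → ℝˡ` be multilinear in the sense that it is affine in each of the
three coordinate blocks separately, with linear parts `A₁ (y, z)`, `A₂ (x, z)` and
`A₃ (x, y)` respectively.  Given `(x, y, z)`, a target value `c`, and the defect
`δc = c - b x y z`, define successively
`x̃ = x + A₁(y,z)ᵀ (A₁(y,z) A₁(y,z)ᵀ)⁻¹ (δc/3)`,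
`ỹ = y + A₂(x̃,z)ᵀ (A₂(x̃,z) A₂(x̃,z)ᵀ)⁻¹ (δc/3)`,
`z̃ = z + A₃(x̃,ỹ)ᵀ (A₃(x̃,ỹ) A₃(x̃,ỹ)ᵀ)⁻¹ (δc/3)`.
If the three Gram matrices involved are invertible, then `b x̃ ỹ z̃ = c`. -/
theorem multilinear_constraint_projection (l p : ℕ)
    (b : (Fin p → ℝ) → (Fin p → ℝ) → (Fin p → ℝ) → Fin l → ℝ)
    (A₁ A₂ A₃ : (Fin p → ℝ) → (Fin p → ℝ) → Matrix (Fin l) (Fin p) ℝ)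
    -- `b` is affine in the first block with linear part `A₁ (y, z)`
    (h1 : ∀ x x' y z, b x y z = b x' y z + A₁ y z *ᵥ (x - x'))
    -- `b` is affine in the second block with linear part `A₂ (x, z)`
    (h2 : ∀ x y y' z, b x y z = b x y' z + A₂ x z *ᵥ (y - y'))
    -- `b` is affine in the third block with linear part `A₃ (x, y)`
    (h3 : ∀ x y z z', b x y z = b x y z' + A₃ x y *ᵥ (z - z'))
    (x y z : Fin p → ℝ) (c : Fin l → ℝ)
    (δc : Fin l → ℝ) (hδc : δc = c - b x y z)
    (xt yt zt : Fin p → ℝ)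
    (hxt : xt = x + (A₁ y z)ᵀ *ᵥ ((A₁ y z * (A₁ y z)ᵀ)⁻¹ *ᵥ ((3 : ℝ)⁻¹ • δc)))
    (hyt : yt = y + (A₂ xt z)ᵀ *ᵥ ((A₂ xt z * (A₂ xt z)ᵀ)⁻¹ *ᵥ ((3 : ℝ)⁻¹ • δc)))
    (hzt : zt = z + (A₃ xt yt)ᵀ *ᵥ ((A₃ xt yt * (A₃ xt yt)ᵀ)⁻¹ *ᵥ ((3 : ℝ)⁻¹ • δc)))
    (hu1 : IsUnit (A₁ y z * (A₁ y z)ᵀ))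
    (hu2 : IsUnit (A₂ xt z * (A₂ xt z)ᵀ))
    (hu3 : IsUnit (A₃ xt yt * (A₃ xt yt)ᵀ)) :
    b xt yt zt = c := by
  have hx : xt - x = _ := sub_eq_iff_eq_add'.mpr hxt
  have hy : yt - y = _ := sub_eq_iff_eq_add'.mpr hyt
  have hz : zt - z = _ := sub_eq_iff_eq_add'.mpr hzt
  rw [h3 xt yt zt z, hz, mulVec_transpose_mulVec_gram_inv_mulVec hu3,
    h2 xt yt y z, hy, mulVec_transpose_mulVec_gram_inv_mulVec hu2,
    h1 xt x y z, hx, mulVec_transpose_mulVec_gram_inv_mulVec hu1, hδc]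
  module
end
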